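/- Let 𝒯 be a first-order theory over a signature Σ, let A and B be disjoint sets of sentences over expansions of Σ by free symbols, and let Σ_I be the expansion of Σ by the free symbols occurring in both A and B. Suppose there is a successful 𝒯-interpolation run (S_A, S_B, ⊏) for A and B: S_A and S_B are disjoint finite sets of Σ_I-sentences with false ∈ S_B, ⊏ is a well-founded partial order on S_A ∪ S_B, and there are functions prB : S_A → 2^{S_B} and prA : S_B → 2^{S_A} such that (1) for every α ∈ S_A, A ∪ prB(α) ⊨_𝒯 α and β ⊏ α for all β ∈ prB(α), and (2) for every β ∈ S_B, B ∪ prA(β) ⊨_𝒯 β and α ⊏ β for all α ∈ prA(β). Then there exists a Σ_I-sentence I such that A ⊨_𝒯 I and B ∪ {I} ⊨_𝒯 false, i.e. I is a 𝒯-interpolant of A and B. -/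

import Mathlib

open FirstOrder Language

universe u v

/-- A function symbol (paired with its arity) occurs in a term. -/
inductive TFunc {L : FirstOrder.Language.{u, v}} {α : Type*} :
    (Σ n, L.Functions n) → L.Term α → Prop
  | head {k : ℕ} (f : L.Functions k) (ts : Fin k → L.Term α) : TFunc ⟨k, f⟩ (Term.func f ts)
  | arg {k : ℕ} (f : L.Functions k) (ts : Fin k → L.Term α) (i : Fin k) {g} :
      TFunc g (ts i) → TFunc g (Term.func f ts)

/-- A function symbol occurs in a bounded formula. -/
inductive FFunc {L : FirstOrder.Language.{u, v}} {α : Type*} :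
    ∀ {n : ℕ}, (Σ k, L.Functions k) → L.BoundedFormula α n → Prop
  | equal_l {n} {t₁ t₂ : L.Term (α ⊕ Fin n)} {g} (h : TFunc g t₁) :
      FFunc g (BoundedFormula.equal t₁ t₂)
  | equal_r {n} {t₁ t₂ : L.Term (α ⊕ Fin n)} {g} (h : TFunc g t₂) :
      FFunc g (BoundedFormula.equal t₁ t₂)
  | rel {n l : ℕ} {R : L.Relations l} {ts : Fin l → L.Term (α ⊕ Fin n)} {g} (i : Fin l)
      (h : TFunc g (ts i)) : FFunc g (BoundedFormula.rel R ts)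
  | imp_l {n} {φ ψ : L.BoundedFormula α n} {g} (h : FFunc g φ) : FFunc g (φ.imp ψ)
  | imp_r {n} {φ ψ : L.BoundedFormula α n} {g} (h : FFunc g ψ) : FFunc g (φ.imp ψ)
  | all {n} {φ : L.BoundedFormula α (n + 1)} {g} (h : FFunc g φ) : FFunc g φ.all

/-- A relation symbol occurs in a bounded formula. -/
inductive FRel {L : FirstOrder.Language.{u, v}} {α : Type*} :
    ∀ {n : ℕ}, (Σ k, L.Relations k) → L.BoundedFormula α n → Prop
  | rel {n l : ℕ} {R : L.Relations l} {ts : Fin l → L.Term (α ⊕ Fin n)} :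
      FRel ⟨l, R⟩ (BoundedFormula.rel R ts)
  | imp_l {n} {φ ψ : L.BoundedFormula α n} {g} (h : FRel g φ) : FRel g (φ.imp ψ)
  | imp_r {n} {φ ψ : L.BoundedFormula α n} {g} (h : FRel g ψ) : FRel g (φ.imp ψ)
  | all {n} {φ : L.BoundedFormula α (n + 1)} {g} (h : FRel g φ) : FRel g φ.all

/-- A structure (given explicitly) satisfies every sentence in `S`. -/
def SatisfiesAll {L : FirstOrder.Language.{u, v}} (M : Type) (str : L.Structure M)
    (S : Set L.Sentence) : Prop :=
  letI := str
  ∀ φ ∈ S, M ⊨ φ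

/-- `S ⊨_T φ` : semantic entailment modulo the theory `T`. -/
def TEntails {L : FirstOrder.Language.{u, v}} (T : L.Theory) (S : Set L.Sentence)
    (φ : L.Sentence) : Prop :=
  ∀ (M : Type) (str : L.Structure M), Nonempty M →
    SatisfiesAll M str T → SatisfiesAll M str S → (letI := str; M ⊨ φ)

/-- The theory uses only symbols of the signature given by `SF`, `SR`. -/
def TheoryOverSig {L : FirstOrder.Language.{u, v}} (SF : Set (Σ k, L.Functions k))
    (SR : Set (Σ k, L.Relations k)) (T : L.Theory) : Prop :=
  ∀ φ ∈ T, (∀ g, FFunc g φ → g ∈ SF) ∧ (∀ g, FRel g φ → g ∈ SR)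

/-- `φ` is a `Σ_I`-sentence: each of its non-theory symbols occurs both in `A`
and in `B`. -/
def SigISentence {L : FirstOrder.Language.{u, v}} (SF : Set (Σ k, L.Functions k))
    (SR : Set (Σ k, L.Relations k)) (A B : Set L.Sentence) (φ : L.Sentence) : Prop :=
  (∀ g, FFunc g φ → g ∉ SF → (∃ ψ ∈ A, FFunc g ψ) ∧ ∃ ψ ∈ B, FFunc g ψ) ∧
  (∀ g, FRel g φ → g ∉ SR → (∃ ψ ∈ A, FRel g ψ) ∧ ∃ ψ ∈ B, FRel g ψ)

section SignatureClosure

variable {L : FirstOrder.Language.{u, v}} {SF : Set (Σ k, L.Functions k)}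
  {SR : Set (Σ k, L.Relations k)} {A B : Set L.Sentence}

theorem SigISentence.bot : SigISentence SF SR A B (⊥ : L.Sentence) := by
  change SigISentence SF SR A B BoundedFormula.falsum
  constructor <;> intro g hg <;> cases hg

theorem SigISentence.imp {φ ψ : L.Sentence} (hφ : SigISentence SF SR A B φ)
    (hψ : SigISentence SF SR A B ψ) :
    SigISentence SF SR A B (BoundedFormula.imp φ ψ : L.Sentence) := by
  constructor <;> intro g hg
  · cases hg with
    | imp_l h => exact hφ.1 g h
    | imp_r h => exact hψ.1 g h
  · cases hg with
    | imp_l h => exact hφ.2 g h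
    | imp_r h => exact hψ.2 g h

theorem SigISentence.not {φ : L.Sentence} (hφ : SigISentence SF SR A B φ) :
    SigISentence SF SR A B (BoundedFormula.not φ : L.Sentence) :=
  hφ.imp .bot

theorem SigISentence.inf {φ ψ : L.Sentence} (hφ : SigISentence SF SR A B φ)
    (hψ : SigISentence SF SR A B ψ) : SigISentence SF SR A B (φ ⊓ ψ) :=
  (hφ.imp hψ.not).not

/-- A finite set of sentences over the common signature is equivalent to a single one. -/
theorem exists_sigISentence_iff_satisfiesAll {S : Set L.Sentence} (hfin : S.Finite)
    (hS : ∀ φ ∈ S, SigISentence SF SR A B φ) :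
    ∃ χ : L.Sentence, SigISentence SF SR A B χ ∧
      ∀ (M : Type) (str : L.Structure M), (letI := str; M ⊨ χ) ↔ SatisfiesAll M str S := by
  induction S, hfin using Set.Finite.induction_on with
  | empty =>
    exact ⟨⊤, SigISentence.bot.not, fun M str => by simp [SatisfiesAll, Sentence.Realize]⟩
  | @insert φ S _ _ ih =>
    obtain ⟨χ, hχ, hiff⟩ := ih fun ψ hψ => hS ψ (Set.mem_insert_of_mem _ hψ)
    refine ⟨φ ⊓ χ, (hS φ (Set.mem_insert _ _)).inf hχ, fun M str => ?_⟩
    have h := hiff M str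
    simp only [SatisfiesAll, Sentence.Realize, Set.forall_mem_insert, Formula.realize_inf] at h ⊢
    rw [h]

end SignatureClosure

/-- Given a successful `T`-interpolation run `(SA, SB, lt)` for
`A` and `B` (i.e. one with `⊥ ∈ SB`), there is a `Σ_I`-sentence `I` such that
`A ⊨_T I` and `B ∪ {I} ⊨_T ⊥`: a `T`-interpolant of `A` and `B`. -/
theorem successful_interpolation_run_yields_interpolant
    {L : FirstOrder.Language.{u, v}} (SF : Set (Σ k, L.Functions k))
    (SR : Set (Σ k, L.Relations k)) (T : L.Theory) (hT : TheoryOverSig SF SR T)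
    (A B : Set L.Sentence) (hABdisj : Disjoint A B)
    (SA SB : Set L.Sentence) (hSdisj : Disjoint SA SB)
    (hSAfin : SA.Finite) (hSBfin : SB.Finite)
    (hSsig : ∀ φ ∈ SA ∪ SB, SigISentence SF SR A B φ)
    (hsucc : (⊥ : L.Sentence) ∈ SB)
    (lt : L.Sentence → L.Sentence → Prop)
    (hwf : WellFounded lt) (htrans : Transitive lt)
    (prB prA : L.Sentence → Set L.Sentence)
    (hprB : ∀ α ∈ SA, prB α ⊆ SB ∧ TEntails T (A ∪ prB α) α ∧ ∀ β ∈ prB α, lt β α)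
    (hprA : ∀ β ∈ SB, prA β ⊆ SA ∧ TEntails T (B ∪ prA β) β ∧ ∀ α ∈ prA β, lt α β) :
    ∃ I : L.Sentence, SigISentence SF SR A B I ∧
      TEntails T A I ∧ TEntails T (B ∪ {I}) ⊥ := by
  have hconj (α : L.Sentence) (hα : α ∈ SA) := exists_sigISentence_iff_satisfiesAll
    (hSBfin.subset (hprB α hα).1) fun φ hφ => hSsig φ (Or.inr ((hprB α hα).1 hφ))
  choose! χ hχsig hχ using hconj
  obtain ⟨I, hIsig, hI⟩ := exists_sigISentence_iff_satisfiesAll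
    (S := (fun α => (BoundedFormula.imp (χ α) α : L.Sentence)) '' SA) (hSAfin.image _) (by
      rintro _ ⟨α, hα, rfl⟩
      exact (hχsig α hα).imp (hSsig α (Or.inl hα)))
  refine ⟨I, hIsig, fun M str hM hMT hMA => ?_, fun M str hM hMT hMBI => ?_⟩
  · rw [hI]
    rintro _ ⟨α, hα, rfl⟩
    refine BoundedFormula.realize_imp.2 fun h => (hprB α hα).2.1 M str hM hMT ?_
    rintro φ (hφ | hφ)
    · exact hMA φ hφ
    · exact (hχ α hα M str).1 h φ hφ
  · have hMI := (hI M str).1 (hMBI I (Or.inr rfl))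
    have key (φ : L.Sentence) : φ ∈ SA ∪ SB → M ⊨ φ := by
      induction φ using hwf.induction with
      | _ φ ih =>
        rintro (hφ | hφ)
        · obtain ⟨hsub, -, hlt⟩ := hprB φ hφ
          exact BoundedFormula.realize_imp.1 (hMI _ ⟨φ, hφ, rfl⟩)
            ((hχ φ hφ M str).2 fun β hβ => ih β (hlt β hβ) (Or.inr (hsub hβ)))
        · obtain ⟨hsub, hent, hlt⟩ := hprA φ hφ
          refine hent M str hM hMT ?_
          rintro ψ (hψ | hψ)
          · exact hMBI ψ (Or.inl hψ)
          · exact ih ψ (hlt ψ hψ) (Or.inl (hsub hψ))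
    exact key ⊥ (Or.inr hsucc)
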